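/- arXiv:1512.08320 — 2 statements merged into one kernel-verified Lean document; each statement's English description precedes it below -/
import Mathlib

section
/- Let X be a Baire topological space, Y a metric space, and f : X × Y → ℝ a function such that for every y ∈ Y the function x ↦ f(x, y) is quasicontinuous and for every x ∈ X the function y ↦ f(x, y) is continuous. Then there exists a sequence (E_n)_{n≥1} of F_σ subsets of X × Y such that D(f) = ⋃_{n=1}^∞ E_n and, for every n and every open set V ⊆ Y with diam V < 1/n, the projection onto X of the set E_n ∩ (X × V) is meager in X. -/
open scoped ENNReal

/-- A function `g : X → ℝ` is quasicontinuous if for every point `x`, every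
neighborhood `U` of `x` and every `ε > 0` there is a nonempty open set `V ⊆ U`
on which `g` is `ε`-close to `g x`. -/
def QuasiContinuous {X : Type*} [TopologicalSpace X] (g : X → ℝ) : Prop :=
  ∀ x : X, ∀ U ∈ nhds x, ∀ ε : ℝ, 0 < ε →
    ∃ V : Set X, IsOpen V ∧ V.Nonempty ∧ V ⊆ U ∧ ∀ v ∈ V, |g v - g x| < ε

/-- An `F_σ` set is a countable union of closed sets. -/
def IsFsigma {X : Type*} [TopologicalSpace X] (s : Set X) : Prop :=
  ∃ F : ℕ → Set X, (∀ n, IsClosed (F n)) ∧ s = ⋃ n, F n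

/-- The set of points having a neighborhood on which the values of `f` differ by at most `ε`. -/
def smallOscillation {Z : Type*} [TopologicalSpace Z] (f : Z → ℝ) (ε : ℝ) : Set Z :=
  {p | ∃ N ∈ nhds p, ∀ a ∈ N, ∀ b ∈ N, |f a - f b| ≤ ε}

theorem isOpen_smallOscillation {Z : Type*} [TopologicalSpace Z] (f : Z → ℝ) (ε : ℝ) :
    IsOpen (smallOscillation f ε) := by
  rw [isOpen_iff_mem_nhds]
  rintro p ⟨N, hN, h⟩
  filter_upwards [eventually_mem_nhds_iff.2 hN] with q hq
  exact ⟨N, hq, h⟩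

theorem continuousAt_iff_forall_mem_smallOscillation {Z : Type*} [TopologicalSpace Z]
    (f : Z → ℝ) (p : Z) :
    ContinuousAt f p ↔ ∀ k : ℕ, p ∈ smallOscillation f (6 * (1 / ((k : ℝ) + 1))) := by
  constructor
  · intro h k
    have hk : (0 : ℝ) < 1 / ((k : ℝ) + 1) := by positivity
    refine ⟨_, h (Metric.ball_mem_nhds (f p) hk), fun a ha b hb => ?_⟩
    have ha : |f a - f p| < 1 / ((k : ℝ) + 1) := ha
    have hb : |f b - f p| < 1 / ((k : ℝ) + 1) := hb
    rw [abs_lt] at ha hb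
    rw [abs_le]
    constructor <;> linarith
  · intro h
    refine Metric.continuousAt_iff'.2 fun ε hε => ?_
    obtain ⟨k, hk⟩ := exists_nat_one_div_lt (show (0 : ℝ) < ε / 6 by positivity)
    obtain ⟨N, hN, hf⟩ := h k
    filter_upwards [hN] with q hq
    rw [Real.dist_eq]
    linarith [hf q hq p (mem_of_mem_nhds hN)]

/-- If `f` is quasicontinuous in the first variable and `A` is a set of points `x` for which
`f (x, ·)` varies by at most `ε` on the open set `V`, then only a nowhere dense set of points
of `closure A` carries large oscillation of `f` above `V`. -/
theorem QuasiContinuous.isNowhereDense_closure_inter {X Y : Type*} [TopologicalSpace X]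
    [TopologicalSpace Y] {f : X × Y → ℝ} (hqc : ∀ y : Y, QuasiContinuous fun x => f (x, y))
    {ε : ℝ} (hε : 0 < ε) {V : Set Y} (hV : IsOpen V) {A : Set X}
    (hA : ∀ x ∈ A, ∀ y ∈ V, ∀ z ∈ V, |f (x, y) - f (x, z)| ≤ ε) :
    IsNowhereDense (closure A ∩ {x | ∃ y ∈ V, (x, y) ∉ smallOscillation f (6 * ε)}) := by
  set S := closure A ∩ {x | ∃ y ∈ V, (x, y) ∉ smallOscillation f (6 * ε)}
  have hSA : closure S ⊆ closure A :=
    closure_minimal Set.inter_subset_left isClosed_closure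
  rw [IsNowhereDense, Set.eq_empty_iff_forall_notMem]
  intro g hg
  obtain ⟨-, -, y₀, hy₀, -⟩ := closure_nonempty_iff.1 ⟨g, interior_subset hg⟩
  obtain ⟨W, hWo, ⟨w₀, hw₀⟩, hWG, hW⟩ :=
    hqc y₀ g _ (isOpen_interior.mem_nhds hg) ε hε
  have key : ∀ w ∈ W, ∀ y ∈ V, |f (w, y) - f (g, y₀)| ≤ 3 * ε := by
    intro w hw y hy
    obtain ⟨T, hTo, ⟨t, ht⟩, hTW, hT⟩ := hqc y w W (hWo.mem_nhds hw) ε hε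
    obtain ⟨a, haT, haA⟩ := mem_closure_iff.1
      (hSA (interior_subset (hWG (hTW ht)))) T hTo ht
    have h₁ := abs_lt.1 (hT a haT)
    have h₂ := abs_le.1 (hA a haA y hy y₀ hy₀)
    have h₃ := abs_lt.1 (hW a (hTW haT))
    rw [abs_le]
    constructor <;> linarith
  obtain ⟨w, hwW, -, y, hy, hosc⟩ :=
    mem_closure_iff.1 (interior_subset (hWG hw₀)) W hWo hw₀
  refine hosc ⟨W ×ˢ V, (hWo.prod hV).mem_nhds ⟨hwW, hy⟩, ?_⟩
  rintro ⟨a, c⟩ ⟨ha, hc⟩ ⟨b, d⟩ ⟨hb, hd⟩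
  have h₁ := abs_le.1 (key a ha c hc)
  have h₂ := abs_le.1 (key b hb d hd)
  rw [abs_le]
  constructor <;> linarith

/-- The set of points `(x, y)` such that `f (x, ·)` varies by at most `ε` on the ball of
radius `r` around `y`. -/
def smallVariation {X Y : Type*} [PseudoEMetricSpace Y] (f : X × Y → ℝ) (ε : ℝ) (r : ℝ≥0∞) :
    Set (X × Y) :=
  {p | ∀ y z : Y, edist y p.2 < r → edist z p.2 < r → |f (p.1, y) - f (p.1, z)| ≤ ε}

theorem exists_mem_smallVariation {X Y : Type*} [PseudoEMetricSpace Y] {f : X × Y → ℝ} {x : X}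
    (hc : Continuous fun y => f (x, y)) (y : Y) {ε : ℝ} (hε : 0 < ε) :
    ∃ n : ℕ, (x, y) ∈ smallVariation f ε (1 / ((n : ℝ≥0∞) + 1)) := by
  have h := hc.continuousAt (x := y) (Metric.ball_mem_nhds _ (half_pos hε))
  obtain ⟨r, hr, hball⟩ := EMetric.mem_nhds_iff.1 h
  obtain ⟨n, hn⟩ := ENNReal.exists_inv_nat_lt hr.ne'
  have hnr : 1 / ((n : ℝ≥0∞) + 1) ≤ r := by
    rw [one_div]
    exact (ENNReal.inv_le_inv.2 le_self_add).trans hn.le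
  refine ⟨n, fun a b ha hb => ?_⟩
  have h₁ : |f (x, a) - f (x, y)| < ε / 2 := hball (lt_of_lt_of_le ha hnr)
  have h₂ : |f (x, b) - f (x, y)| < ε / 2 := hball (lt_of_lt_of_le hb hnr)
  rw [abs_lt] at h₁ h₂
  rw [abs_le]
  constructor <;> linarith

theorem discontinuity_set_of_KC_function
    {X Y : Type*} [TopologicalSpace X] [BaireSpace X] [MetricSpace Y]
    (f : X × Y → ℝ)
    (hqc : ∀ y : Y, QuasiContinuous fun x => f (x, y))
    (hc : ∀ x : X, Continuous fun y => f (x, y)) :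
    ∃ E : ℕ → Set (X × Y),
      (∀ n, IsFsigma (E n)) ∧
      {p | ¬ ContinuousAt f p} = ⋃ n, E n ∧
      ∀ n : ℕ, ∀ V : Set Y, IsOpen V → EMetric.diam V < 1 / ((n : ℝ≥0∞) + 1) →
        IsMeagre (Prod.fst '' (E n ∩ (Set.univ ×ˢ V))) := by
  refine ⟨fun n => ⋃ k : ℕ, closure (smallVariation f (1 / ((k : ℝ) + 1)) (1 / ((n : ℝ≥0∞) + 1)))
    ∩ (smallOscillation f (6 * (1 / ((k : ℝ) + 1))))ᶜ, fun n => ⟨_, fun k =>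
      isClosed_closure.inter (isOpen_smallOscillation _ _).isClosed_compl, rfl⟩, ?_, ?_⟩
  · ext ⟨x, y⟩
    simp only [Set.mem_ofPred_eq, Set.mem_iUnion, continuousAt_iff_forall_mem_smallOscillation,
      not_forall]
    constructor
    · rintro ⟨k, hk⟩
      obtain ⟨n, hn⟩ := exists_mem_smallVariation (hc x) y
        (show (0 : ℝ) < 1 / ((k : ℝ) + 1) by positivity)
      exact ⟨n, k, subset_closure hn, hk⟩
    · rintro ⟨-, k, -, hk⟩
      exact ⟨k, hk⟩
  · intro n V hV hdiam
    rw [Set.iUnion_inter, Set.image_iUnion]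
    refine isMeagre_iUnion fun k => ?_
    set ε : ℝ := 1 / ((k : ℝ) + 1)
    set r : ℝ≥0∞ := 1 / ((n : ℝ≥0∞) + 1)
    have hε : 0 < ε := by positivity
    refine (QuasiContinuous.isNowhereDense_closure_inter hqc hε hV
      (A := {x | ∀ y ∈ V, ∀ z ∈ V, |f (x, y) - f (x, z)| ≤ ε}) fun x hx => hx).isMeagre.mono ?_
    rintro _ ⟨⟨x, y⟩, ⟨⟨hcl, hosc⟩, -, hy⟩, rfl⟩
    refine ⟨mem_closure_iff.2 fun U hU hxU => ?_, y, hy, hosc⟩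
    obtain ⟨⟨a, b⟩, ⟨haU, hbV⟩, hab⟩ := mem_closure_iff.1 hcl (U ×ˢ V) (hU.prod hV) ⟨hxU, hy⟩
    exact ⟨a, haU, fun c hc d hd => hab c d
      ((Metric.edist_le_ediam_of_mem hc hbV).trans_lt hdiam)
      ((Metric.edist_le_ediam_of_mem hd hbV).trans_lt hdiam)⟩
end

section
/- Let X be a Baire topological space, Y a metric space, and f : X × Y → ℝ a function that is quasicontinuous in the first variable (for each fixed y) and continuous in the second variable (for each fixed x). For m, n ∈ ℕ set E_{mn} = {(x, y) ∈ X × Y : ω_f(x, y) ≥ 1/m and ω_{f(x,·)}(B(y, 1/n)) < 1/(4m)}, where B(y, 1/n) is the open ball in Y of radius 1/n about y. Then for every open set V ⊆ Y with diam V < 1/n, the projection onto X of E_{mn} ∩ (X × V) is nowhere dense in X. -/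
open scoped ENNReal

/-- The oscillation `ω_h(A) = sup {|h a' - h a''| : a', a'' ∈ A}`,
as an element of `[0, +∞]`. -/
noncomputable def osc {X : Type*} (h : X → ℝ) (A : Set X) : ℝ≥0∞ :=
  ⨆ a ∈ A, ⨆ b ∈ A, ENNReal.ofReal |h a - h b|

/-- The oscillation of `h` at a point `z`: `ω_h(z) = inf {ω_h(U) : U ∈ 𝓝 z}`. -/
noncomputable def oscAt {X : Type*} [TopologicalSpace X] (h : X → ℝ) (z : X) : ℝ≥0∞ :=
  ⨅ U ∈ nhds z, osc h U

theorem abs_sub_lt_of_osc_lt {X : Type*} {h : X → ℝ} {A : Set X} {r : ℝ}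
    (hr : osc h A < ENNReal.ofReal r) {a b : X} (ha : a ∈ A) (hb : b ∈ A) :
    |h a - h b| < r := by
  have hle : ENNReal.ofReal |h a - h b| ≤ osc h A :=
    (le_iSup₂ (f := fun b (_ : b ∈ A) => ENNReal.ofReal |h a - h b|) b hb).trans
      (le_iSup₂ (f := fun a (_ : a ∈ A) => ⨆ b ∈ A, ENNReal.ofReal |h a - h b|) a ha)
  exact (ENNReal.ofReal_lt_ofReal_iff_of_nonneg (abs_nonneg _)).1 (hle.trans_lt hr)

theorem osc_le_of_abs_sub_le {X : Type*} {h : X → ℝ} {A : Set X} {c r : ℝ}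
    (hc : ∀ a ∈ A, |h a - c| ≤ r) : osc h A ≤ ENNReal.ofReal (2 * r) := by
  refine iSup₂_le fun a ha => iSup₂_le fun b hb => ENNReal.ofReal_le_ofReal ?_
  have h₁ := abs_le.1 (hc a ha)
  have h₂ := abs_le.1 (hc b hb)
  exact abs_le.2 ⟨by linarith, by linarith⟩

/-- A quasicontinuous function that stays within `r` of `c` on a dense part of an open set `W`
stays within any larger distance of `c` on all of `W`. -/
theorem QuasiContinuous.abs_sub_le_of_subset_closure {X : Type*} [TopologicalSpace X]
    {g : X → ℝ} (hg : QuasiContinuous g) {W P : Set X} (hW : IsOpen W) (hWP : W ⊆ closure P)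
    {c r ε : ℝ} (hε : 0 < ε) (hP : ∀ x ∈ W ∩ P, |g x - c| ≤ r) {x : X} (hx : x ∈ W) :
    |g x - c| ≤ r + ε := by
  obtain ⟨O, hO, ⟨o, ho⟩, hOW, hclose⟩ := hg x W (hW.mem_nhds hx) ε hε
  obtain ⟨v, hvO, hvP⟩ := mem_closure_iff.1 (hWP (hOW ho)) O hO ho
  have h₁ := abs_lt.1 (hclose v hvO)
  have h₂ := abs_le.1 (hP v ⟨hOW hvO, hvP⟩)
  exact abs_le.2 ⟨by linarith, by linarith⟩

theorem projection_Emn_nowhereDense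
    {X Y : Type*} [TopologicalSpace X] [BaireSpace X] [MetricSpace Y]
    (f : X × Y → ℝ)
    (hqc : ∀ y : Y, QuasiContinuous fun x => f (x, y))
    (hc : ∀ x : X, Continuous fun y => f (x, y))
    (m n : ℕ) (hm : 0 < m) (hn : 0 < n)
    (E : Set (X × Y))
    (hE : E = {p : X × Y | 1 / (m : ℝ≥0∞) ≤ oscAt f p ∧
      osc (fun y' => f (p.1, y')) (Metric.ball p.2 (1 / (n : ℝ))) < 1 / (4 * (m : ℝ≥0∞))})
    (V : Set Y) (hV : IsOpen V) (hdiam : EMetric.diam V < 1 / (n : ℝ≥0∞)) :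
    IsNowhereDense (Prod.fst '' (E ∩ (Set.univ ×ˢ V))) := by
  have hm' : (0 : ℝ) < m := Nat.cast_pos.2 hm
  have hn' : (0 : ℝ) < n := Nat.cast_pos.2 hn
  have hm_eq : 1 / (m : ℝ≥0∞) = ENNReal.ofReal (1 / m) := by
    rw [ENNReal.ofReal_div_of_pos hm', ENNReal.ofReal_one, ENNReal.ofReal_natCast]
  have h4m_eq : 1 / (4 * (m : ℝ≥0∞)) = ENNReal.ofReal (1 / (4 * m)) := by
    rw [ENNReal.ofReal_div_of_pos (by positivity), ENNReal.ofReal_mul (by norm_num)]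
    simp
  have hn_eq : 1 / (n : ℝ≥0∞) = ENNReal.ofReal (1 / n) := by
    rw [ENNReal.ofReal_div_of_pos hn', ENNReal.ofReal_one, ENNReal.ofReal_natCast]
  set P := Prod.fst '' (E ∩ (Set.univ ×ˢ V))
  have hVosc : ∀ x ∈ P, ∀ y ∈ V, ∀ y' ∈ V, |f (x, y) - f (x, y')| < 1 / (4 * m) := by
    rintro _ ⟨⟨x, z⟩, ⟨hxE, -, hz⟩, rfl⟩ y hy y' hy'
    rw [hE] at hxE
    have hball : ∀ w ∈ V, w ∈ Metric.ball z (1 / (n : ℝ)) := fun w hw => by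
      have := (Metric.edist_le_ediam_of_mem hw hz).trans_lt hdiam
      rw [hn_eq, edist_dist] at this
      exact (ENNReal.ofReal_lt_ofReal_iff_of_nonneg dist_nonneg).1 this
    exact abs_sub_lt_of_osc_lt (h := fun y' => f (x, y')) (hxE.2.trans_eq h4m_eq)
      (hball y hy) (hball y' hy')
  rw [IsNowhereDense, Set.eq_empty_iff_forall_notMem]
  intro x₀ hx₀
  obtain ⟨_, -, ⟨⟨_, y₀⟩, ⟨-, -, hy₀⟩, -⟩⟩ :=
    mem_closure_iff.1 (interior_subset hx₀) _ isOpen_univ trivial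
  have hε : (0 : ℝ) < 1 / (16 * m) := by positivity
  obtain ⟨W, hW, ⟨w, hw⟩, hWU, hclose⟩ :=
    hqc y₀ x₀ _ (isOpen_interior.mem_nhds hx₀) _ hε
  have hWP : W ⊆ closure P := hWU.trans interior_subset
  have hbound : ∀ p ∈ W ×ˢ V,
      |f p - f (x₀, y₀)| ≤ (1 / (4 * m) + 1 / (16 * m)) + 1 / (16 * m) := by
    rintro ⟨x, y⟩ ⟨hx, hy⟩
    refine (hqc y).abs_sub_le_of_subset_closure hW hWP hε (fun v hv => ?_) hx
    exact (abs_sub_le _ (f (v, y₀)) _).trans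
      (add_le_add (hVosc v hv.2 y hy y₀ hy₀).le (hclose v hv.1).le)
  obtain ⟨_, hxW, ⟨⟨x, y⟩, ⟨hxE, -, hy⟩, rfl⟩⟩ := mem_closure_iff.1 (hWP hw) W hW hw
  rw [hE] at hxE
  have hle : 1 / (m : ℝ≥0∞) ≤
      ENNReal.ofReal (2 * ((1 / (4 * m) + 1 / (16 * m)) + 1 / (16 * m))) :=
    hxE.1.trans <| (iInf₂_le _ ((hW.prod hV).mem_nhds ⟨hxW, hy⟩)).trans
      (osc_le_of_abs_sub_le hbound)
  rw [hm_eq, ENNReal.ofReal_le_ofReal_iff (by positivity)] at hle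
  have heq : 2 * ((1 / (4 * m) + 1 / (16 * m)) + 1 / (16 * m)) = 3 / 4 * (1 / (m : ℝ)) := by
    field_simp
    norm_num
  have hpos : 0 < 1 / (m : ℝ) := by positivity
  linarith
end
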